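/- If R is a ring with l.wGgldim(R) < ∞, then every Gorenstein projective R-module is Gorenstein flat. -/

import Mathlib

universe u

open CategoryTheory

/-- `extVanish R n M N` asserts that `Ext_R^n(M, N) = 0`. -/
def extVanish (R : Type u) [Ring R] (n : ℕ) (M N : ModuleCat.{u} R) : Prop :=
  letI := HasDerivedCategory.standard (ModuleCat.{u} R)
  letI : HasExt.{u + 1} (ModuleCat.{u} R) := hasExt_of_hasDerivedCategory _
  Subsingleton (Abelian.Ext M N n)

/-- A module `G` is Gorenstein projective if there is an exact sequence of projective
modules `⋯ → P i → P (i+1) → ⋯` with `G ≅ Im (d 0)` which stays exact after applying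
`Hom_R(−, Q)` for every projective module `Q`. -/
def IsGorensteinProjective (R : Type u) [Ring R] (G : ModuleCat.{u} R) : Prop :=
  ∃ (P : ℤ → ModuleCat.{u} R) (d : ∀ i : ℤ, P i →ₗ[R] P (i + 1)),
    (∀ i, Module.Projective R (P i)) ∧
    (∀ i, LinearMap.range (d i) = LinearMap.ker (d (i + 1))) ∧
    Nonempty (G ≃ₗ[R] LinearMap.range (d 0)) ∧
    ∀ (Q : ModuleCat.{u} R), Module.Projective R Q →
      ∀ (i : ℤ) (f : P (i + 1) →ₗ[R] Q), f ∘ₗ d i = 0 →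
        ∃ g : P (i + 1 + 1) →ₗ[R] Q, g ∘ₗ d (i + 1) = f

/-- A module `G` is Gorenstein injective if there is an exact sequence of injective
modules `⋯ → I i → I (i+1) → ⋯` with `G ≅ Im (d 0)` which stays exact after applying
`Hom_R(E, −)` for every injective module `E`. -/
def IsGorensteinInjective (R : Type u) [Ring R] (G : ModuleCat.{u} R) : Prop :=
  ∃ (I : ℤ → ModuleCat.{u} R) (d : ∀ i : ℤ, I i →ₗ[R] I (i + 1)),
    (∀ i, Module.Injective R (I i)) ∧
    (∀ i, LinearMap.range (d i) = LinearMap.ker (d (i + 1))) ∧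
    Nonempty (G ≃ₗ[R] LinearMap.range (d 0)) ∧
    ∀ (E : ModuleCat.{u} R), Module.Injective R E →
      ∀ (i : ℤ) (f : E →ₗ[R] I (i + 1)), d (i + 1) ∘ₗ f = 0 →
        ∃ g : E →ₗ[R] I i, d i ∘ₗ g = f
open MulOpposite in
/-- The subgroup of `I ⊗[ℤ] M` generated by the elements `(x · r) ⊗ y - x ⊗ (r · y)`,
where `I` is a right `R`-module and `M` is a left `R`-module. -/
noncomputable def tensorRel (R : Type u) [Ring R] (I M : Type u) [AddCommGroup I] [Module Rᵐᵒᵖ I]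
    [AddCommGroup M] [Module R M] : AddSubgroup (TensorProduct ℤ I M) :=
  AddSubgroup.closure
    {z | ∃ (r : R) (x : I) (y : M), z = (op r • x) ⊗ₜ[ℤ] y - x ⊗ₜ[ℤ] (r • y)}

/-- The tensor product `I ⊗_R M` of a right `R`-module `I` with a left `R`-module `M`
over an arbitrary ring `R`, realized as a quotient of `I ⊗[ℤ] M`. -/
noncomputable def RTensor (R : Type u) [Ring R] (I M : Type u) [AddCommGroup I] [Module Rᵐᵒᵖ I]
    [AddCommGroup M] [Module R M] : Type u :=
  TensorProduct ℤ I M ⧸ tensorRel R I M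

noncomputable instance (R : Type u) [Ring R] (I M : Type u) [AddCommGroup I]
    [Module Rᵐᵒᵖ I] [AddCommGroup M] [Module R M] : AddCommGroup (RTensor R I M) :=
  QuotientAddGroup.Quotient.addCommGroup _

open MulOpposite in
/-- The map `I ⊗_R M →+ I ⊗_R M'` induced on tensor products by an `R`-linear map
`f : M →ₗ[R] M'`. -/
noncomputable def RTensor.mapRight (R : Type u) [Ring R] (I : Type u) [AddCommGroup I]
    [Module Rᵐᵒᵖ I] {M M' : Type u} [AddCommGroup M] [Module R M] [AddCommGroup M']
    [Module R M'] (f : M →ₗ[R] M') : RTensor R I M →+ RTensor R I M' :=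
  QuotientAddGroup.map _ _
    (TensorProduct.map (LinearMap.id) f.toAddMonoidHom.toIntLinearMap).toAddMonoidHom
    (by
      refine (AddSubgroup.closure_le _).2 ?_
      rintro z ⟨r, x, y, rfl⟩
      refine AddSubgroup.subset_closure ⟨r, x, f y, ?_⟩
      simp [TensorProduct.map_tmul, map_sub, map_smul])

open MulOpposite in
/-- The map `I ⊗_R M →+ I' ⊗_R M` induced on tensor products by a map of right modules
`f : I →ₗ[Rᵐᵒᵖ] I'`. -/
noncomputable def RTensor.mapLeft (R : Type u) [Ring R] {I I' : Type u} [AddCommGroup I]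
    [Module Rᵐᵒᵖ I] [AddCommGroup I'] [Module Rᵐᵒᵖ I'] (f : I →ₗ[Rᵐᵒᵖ] I')
    (M : Type u) [AddCommGroup M] [Module R M] : RTensor R I M →+ RTensor R I' M :=
  QuotientAddGroup.map _ _
    (TensorProduct.map f.toAddMonoidHom.toIntLinearMap (LinearMap.id)).toAddMonoidHom
    (by
      refine (AddSubgroup.closure_le _).2 ?_
      rintro z ⟨r, x, y, rfl⟩
      refine AddSubgroup.subset_closure ⟨r, f x, y, ?_⟩
      simp [TensorProduct.map_tmul, map_sub, map_smul])

/-- A left `R`-module `M` over an arbitrary ring `R` is flat if tensoring with `M`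
preserves injectivity of maps of right `R`-modules. -/
def IsFlatModule (R : Type u) [Ring R] (M : Type u) [AddCommGroup M] [Module R M] : Prop :=
  ∀ (A B : Type u) [AddCommGroup A] [Module Rᵐᵒᵖ A] [AddCommGroup B] [Module Rᵐᵒᵖ B]
    (f : A →ₗ[Rᵐᵒᵖ] B), Function.Injective f → Function.Injective (RTensor.mapLeft R f M)

/-- A module `M` is Gorenstein flat if there is an exact sequence of flat modules
`⋯ → F i → F (i+1) → ⋯` with `M ≅ Im (d 0)` which stays exact after applying
`I ⊗_R −` for every injective right `R`-module `I`. -/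
def IsGorensteinFlat (R : Type u) [Ring R] (M : ModuleCat.{u} R) : Prop :=
  ∃ (F : ℤ → ModuleCat.{u} R) (d : ∀ i : ℤ, F i →ₗ[R] F (i + 1)),
    (∀ i, IsFlatModule R (F i)) ∧
    (∀ i, LinearMap.range (d i) = LinearMap.ker (d (i + 1))) ∧
    Nonempty (M ≃ₗ[R] LinearMap.range (d 0)) ∧
    ∀ (I : Type u) [AddCommGroup I] [Module Rᵐᵒᵖ I], Module.Injective Rᵐᵒᵖ I →
      ∀ i : ℤ, (RTensor.mapRight R I (d i)).range = (RTensor.mapRight R I (d (i + 1))).ker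

/-- `gfdLE R n M` means that `M` admits a resolution `0 → Gₙ → ⋯ → G₀ → M → 0` by
Gorenstein flat modules, i.e. the Gorenstein flat dimension of `M` is at most `n`. -/
def gfdLE (R : Type u) [Ring R] : ℕ → ModuleCat.{u} R → Prop
  | 0, M => IsGorensteinFlat R M
  | n + 1, M => ∃ (K G : ModuleCat.{u} R) (f : K →ₗ[R] G) (g : G →ₗ[R] M),
      IsGorensteinFlat R G ∧ Function.Injective f ∧ Function.Surjective g ∧
      LinearMap.range f = LinearMap.ker g ∧ gfdLE R n K

/-- The Gorenstein flat dimension of `M` as an element of `ℕ∞` (`⊤` if `M` has no finite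
Gorenstein flat resolution). -/
noncomputable def gfd (R : Type u) [Ring R] (M : ModuleCat.{u} R) : ℕ∞ :=
  sInf {n : ℕ∞ | ∃ m : ℕ, n = (m : ℕ∞) ∧ gfdLE R m M}

section ExtVanishing

open Abelian

universe v w

variable {C : Type v} [Category.{w} C] [Abelian C] [HasExt.{w} C]

lemma CategoryTheory.ShortComplex.ShortExact.subsingleton_ext_X₃ {S : ShortComplex C}
    (hS : S.ShortExact) (Y : C) (n : ℕ) (h₁ : Subsingleton (Ext S.X₁ Y n))
    (h₂ : Subsingleton (Ext S.X₂ Y (n + 1))) : Subsingleton (Ext S.X₃ Y (n + 1)) := by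
  refine subsingleton_of_forall_eq 0 fun x ↦ ?_
  obtain ⟨y, rfl⟩ := Ext.contravariant_sequence_exact₃ hS Y x (Subsingleton.elim _ _)
    (Nat.add_comm 1 n)
  rw [Subsingleton.elim y 0, Ext.comp_zero]

lemma CategoryTheory.ShortComplex.ShortExact.subsingleton_ext_X₁ {S : ShortComplex C}
    (hS : S.ShortExact) (Y : C) (n : ℕ) (h₂ : Subsingleton (Ext S.X₂ Y n))
    (h₃ : Subsingleton (Ext S.X₃ Y (n + 1))) : Subsingleton (Ext S.X₁ Y n) := by
  refine subsingleton_of_forall_eq 0 fun x ↦ ?_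
  obtain ⟨y, rfl⟩ := Ext.contravariant_sequence_exact₁ hS Y x (Nat.add_comm 1 n)
    (Subsingleton.elim _ _)
  rw [Subsingleton.elim y 0, Ext.comp_zero]

lemma CategoryTheory.ShortComplex.ShortExact.subsingleton_ext_one {S : ShortComplex C}
    (hS : S.ShortExact) (Y : C) (h : ∀ f : S.X₁ ⟶ Y, ∃ g : S.X₂ ⟶ Y, S.f ≫ g = f)
    (h₂ : Subsingleton (Ext S.X₂ Y 1)) : Subsingleton (Ext S.X₃ Y 1) := by
  refine subsingleton_of_forall_eq 0 fun x ↦ ?_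
  obtain ⟨y, rfl⟩ := Ext.contravariant_sequence_exact₃ hS Y x (Subsingleton.elim _ _)
    (Nat.add_zero 1)
  obtain ⟨f, rfl⟩ := (Ext.mk₀_bijective _ _).2 y
  obtain ⟨g, rfl⟩ := h f
  rw [← Ext.mk₀_comp_mk₀, hS.extClass_comp_assoc]

lemma CategoryTheory.ShortComplex.ShortExact.exists_comp_eq_of_subsingleton_ext_one
    {S : ShortComplex C} (hS : S.ShortExact) (Y : C) (h₃ : Subsingleton (Ext S.X₃ Y 1))
    (f : S.X₁ ⟶ Y) : ∃ g : S.X₂ ⟶ Y, S.f ≫ g = f := by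
  obtain ⟨y, hy⟩ := Ext.contravariant_sequence_exact₁ hS Y (Ext.mk₀ f) (Nat.add_zero 1)
    (Subsingleton.elim _ _)
  obtain ⟨g, rfl⟩ := (Ext.mk₀_bijective _ _).2 y
  rw [Ext.mk₀_comp_mk₀] at hy
  exact ⟨g, (Ext.mk₀_bijective _ _).1 hy⟩

lemma CategoryTheory.Iso.subsingleton_ext {M N : C} (e : M ≅ N) (Y : C) (n : ℕ)
    (h : Subsingleton (Ext N Y n)) : Subsingleton (Ext M Y n) := by
  refine subsingleton_of_forall_eq 0 fun x ↦ ?_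
  rw [← Ext.mk₀_id_comp x, ← e.hom_inv_id, ← Ext.mk₀_comp_mk₀_assoc,
    Subsingleton.elim ((Ext.mk₀ e.inv).comp x (zero_add n)) 0, Ext.comp_zero]

end ExtVanishing

section Duality

open MulOpposite TensorProduct

variable (R : Type u) [Ring R]

/-- The character module of a right `R`-module, as a left `R`-module. -/
def RightModuleDual (I : Type u) [AddCommGroup I] [Module Rᵐᵒᵖ I] : Type u :=
  CharacterModule I

/-- The character module of a left `R`-module, as a right `R`-module. -/
def LeftModuleDual (M : Type u) [AddCommGroup M] [Module R M] : Type u :=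
  CharacterModule M

variable (I : Type u) [AddCommGroup I] [Module Rᵐᵒᵖ I]
variable (M : Type u) [AddCommGroup M] [Module R M]

noncomputable instance : AddCommGroup (RightModuleDual R I) :=
  inferInstanceAs (AddCommGroup (CharacterModule I))

noncomputable instance : AddCommGroup (LeftModuleDual R M) :=
  inferInstanceAs (AddCommGroup (CharacterModule M))

instance : FunLike (RightModuleDual R I) I (AddCircle (1 : ℚ)) :=
  inferInstanceAs (FunLike (CharacterModule I) I (AddCircle (1 : ℚ)))

instance : FunLike (LeftModuleDual R M) M (AddCircle (1 : ℚ)) :=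
  inferInstanceAs (FunLike (CharacterModule M) M (AddCircle (1 : ℚ)))

instance : AddMonoidHomClass (RightModuleDual R I) I (AddCircle (1 : ℚ)) :=
  inferInstanceAs (AddMonoidHomClass (CharacterModule I) I (AddCircle (1 : ℚ)))

instance : AddMonoidHomClass (LeftModuleDual R M) M (AddCircle (1 : ℚ)) :=
  inferInstanceAs (AddMonoidHomClass (CharacterModule M) M (AddCircle (1 : ℚ)))

variable {R I M}

@[simp] lemma LeftModuleDual.zero_apply (x : M) : (0 : LeftModuleDual R M) x = 0 := rfl

noncomputable instance : Module R (RightModuleDual R I) where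
  smul r φ := AddMonoidHom.comp (M := I) (N := I) (P := AddCircle (1 : ℚ)) φ
    (DistribSMul.toAddMonoidHom I (op r))
  one_smul φ := DFunLike.ext _ _ fun x ↦ congrArg φ (one_smul Rᵐᵒᵖ x)
  mul_smul r s φ := DFunLike.ext _ _ fun x ↦ congrArg φ (mul_smul (op s) (op r) x)
  smul_zero _ := rfl
  smul_add _ _ _ := rfl
  add_smul r s φ := DFunLike.ext _ _ fun x ↦
    (congrArg φ (add_smul (op r) (op s) x)).trans (map_add φ _ _)
  zero_smul φ := DFunLike.ext _ _ fun x ↦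
    (congrArg φ (zero_smul Rᵐᵒᵖ x)).trans (map_zero φ)

noncomputable instance : Module Rᵐᵒᵖ (LeftModuleDual R M) where
  smul r φ := AddMonoidHom.comp (M := M) (N := M) (P := AddCircle (1 : ℚ)) φ
    (DistribSMul.toAddMonoidHom M (unop r))
  one_smul φ := DFunLike.ext _ _ fun x ↦ congrArg φ (one_smul R x)
  mul_smul r s φ := DFunLike.ext _ _ fun x ↦ congrArg φ (mul_smul (unop s) (unop r) x)
  smul_zero _ := rfl
  smul_add _ _ _ := rfl
  add_smul r s φ := DFunLike.ext _ _ fun x ↦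
    (congrArg φ (add_smul (unop r) (unop s) x)).trans (map_add φ _ _)
  zero_smul φ := DFunLike.ext _ _ fun x ↦
    (congrArg φ (zero_smul R x)).trans (map_zero φ)

variable {I' M' : Type u} [AddCommGroup I'] [Module Rᵐᵒᵖ I'] [AddCommGroup M'] [Module R M']

/-- The map of character modules induced by a map of right modules. -/
noncomputable def RightModuleDual.map (f : I →ₗ[Rᵐᵒᵖ] I') :
    RightModuleDual R I' →ₗ[R] RightModuleDual R I where
  toFun φ := AddMonoidHom.comp (M := I) (N := I') (P := AddCircle (1 : ℚ)) φ f.toAddMonoidHom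
  map_add' _ _ := rfl
  map_smul' r φ := DFunLike.ext _ _ fun x ↦ congrArg φ (map_smul f (op r) x).symm

/-- The map of character modules induced by a map of left modules. -/
noncomputable def LeftModuleDual.map (f : M →ₗ[R] M') :
    LeftModuleDual R M' →ₗ[Rᵐᵒᵖ] LeftModuleDual R M where
  toFun φ := AddMonoidHom.comp (M := M) (N := M') (P := AddCircle (1 : ℚ)) φ f.toAddMonoidHom
  map_add' _ _ := rfl
  map_smul' r φ := DFunLike.ext _ _ fun x ↦ congrArg φ (map_smul f (unop r) x).symm

@[simp] lemma LeftModuleDual.map_apply (f : M →ₗ[R] M') (φ : LeftModuleDual R M') (x : M) :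
    LeftModuleDual.map f φ x = φ (f x) := rfl

lemma exists_character_comp_eq {A B : Type u} [AddCommGroup A] [AddCommGroup B] (f : A →+ B)
    (hf : Function.Injective f) (φ : CharacterModule A) :
    ∃ ψ : CharacterModule B, ∀ a, ψ (f a) = φ a := by
  obtain ⟨ψ, rfl⟩ := CharacterModule.dual_surjective_of_injective f.toIntLinearMap hf φ
  exact ⟨ψ, fun _ ↦ rfl⟩

lemma RightModuleDual.map_surjective (f : I →ₗ[Rᵐᵒᵖ] I') (hf : Function.Injective f) :
    Function.Surjective (RightModuleDual.map f) := fun φ ↦ by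
  obtain ⟨ψ, hψ⟩ := exists_character_comp_eq f.toAddMonoidHom hf φ
  exact ⟨ψ, DFunLike.ext _ _ hψ⟩

lemma LeftModuleDual.map_surjective (f : M →ₗ[R] M') (hf : Function.Injective f) :
    Function.Surjective (LeftModuleDual.map f) := fun φ ↦ by
  obtain ⟨ψ, hψ⟩ := exists_character_comp_eq f.toAddMonoidHom hf φ
  exact ⟨ψ, DFunLike.ext _ _ hψ⟩

/-- The correspondence between maps into character modules of left and right modules. -/
noncomputable def flipToLeftDual (f : M →ₗ[R] RightModuleDual R I) :
    I →ₗ[Rᵐᵒᵖ] LeftModuleDual R M where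
  toFun x := AddMonoidHom.mk' (fun y ↦ f y x) fun y z ↦ by rw [map_add]; rfl
  map_add' x x' := DFunLike.ext _ _ fun y ↦ map_add (f y) x x'
  map_smul' r x := DFunLike.ext _ _ fun y ↦ (DFunLike.congr_fun (map_smul f (unop r) y) x).symm

/-- The correspondence between maps into character modules of right and left modules. -/
noncomputable def flipToRightDual (f : I →ₗ[Rᵐᵒᵖ] LeftModuleDual R M) :
    M →ₗ[R] RightModuleDual R I where
  toFun y := AddMonoidHom.mk' (fun x ↦ f x y) fun x z ↦ by rw [map_add]; rfl
  map_add' y y' := DFunLike.ext _ _ fun x ↦ map_add (f x) y y'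
  map_smul' r y := DFunLike.ext _ _ fun x ↦ (DFunLike.congr_fun (map_smul f (op r) x) y).symm

/-- The class of `x ⊗ y` in `I ⊗_R M`. -/
noncomputable def RTensor.tmul (x : I) (y : M) : RTensor R I M :=
  QuotientAddGroup.mk (s := tensorRel R I M) (x ⊗ₜ[ℤ] y)

@[simp] lemma RTensor.mapRight_tmul (f : M →ₗ[R] M') (x : I) (y : M) :
    RTensor.mapRight R I f (RTensor.tmul x y) = RTensor.tmul x (f y) := rfl

lemma RTensor.addHom_ext {A : Type*} [AddCommGroup A] {φ ψ : RTensor R I M →+ A}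
    (h : ∀ x y, φ (RTensor.tmul x y) = ψ (RTensor.tmul x y)) : φ = ψ := by
  refine QuotientAddGroup.addMonoidHom_ext _ (AddMonoidHom.ext fun z ↦ ?_)
  induction z using TensorProduct.induction_on with
  | zero => simp only [map_zero]
  | tmul x y => exact h x y
  | add a b ha hb => rw [map_add, map_add, ha, hb]

/-- The additive map on `I ⊗_R M` corresponding to an `R`-linear map `M → I⁺`. -/
noncomputable def RTensor.uncurry (f : M →ₗ[R] RightModuleDual R I) :
    RTensor R I M →+ AddCircle (1 : ℚ) :=
  QuotientAddGroup.lift (tensorRel R I M)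
    (TensorProduct.liftAddHom
      (AddMonoidHom.mk' (fun x ↦ AddMonoidHom.mk' (fun y ↦ f y x) fun y z ↦ by rw [map_add]; rfl)
        fun x x' ↦ AddMonoidHom.ext fun y ↦ map_add (f y) x x')
      fun n x y ↦ (map_zsmul (f y) n x).trans (by rw [map_zsmul]; rfl))
    (by
      refine (AddSubgroup.closure_le _).2 ?_
      rintro z ⟨r, x, y, rfl⟩
      refine (map_sub _ _ _).trans (sub_eq_zero.2 ?_)
      exact (DFunLike.congr_fun (map_smul f r y) x).symm)

lemma RTensor.tmul_smul (r : R) (x : I) (y : M) :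
    RTensor.tmul x (r • y) = RTensor.tmul (R := R) (op r • x) y :=
  (QuotientAddGroup.eq_iff_sub_mem (N := tensorRel R I M)).2
    (AddSubgroup.subset_closure ⟨r, x, y, rfl⟩) |>.symm

lemma RTensor.tmul_add (x : I) (y z : M) :
    RTensor.tmul x (y + z) = RTensor.tmul (R := R) x y + RTensor.tmul x z := by
  rw [RTensor.tmul, TensorProduct.tmul_add]; rfl

lemma RTensor.add_tmul (x z : I) (y : M) :
    RTensor.tmul (x + z) y = RTensor.tmul (R := R) x y + RTensor.tmul z y := by
  rw [RTensor.tmul, TensorProduct.add_tmul]; rfl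

/-- The `R`-linear map `M → I⁺` corresponding to an additive map on `I ⊗_R M`. -/
noncomputable def RTensor.curry (φ : RTensor R I M →+ AddCircle (1 : ℚ)) :
    M →ₗ[R] RightModuleDual R I where
  toFun y := AddMonoidHom.mk' (fun x ↦ φ (RTensor.tmul x y)) fun x x' ↦ by
    rw [RTensor.add_tmul, map_add]
  map_add' y y' := DFunLike.ext _ _ fun x ↦
    (congrArg φ (RTensor.tmul_add x y y')).trans (map_add φ _ _)
  map_smul' r y := DFunLike.ext _ _ fun x ↦ congrArg φ (RTensor.tmul_smul r x y)

lemma IsFlatModule.injective_leftModuleDual (hM : IsFlatModule R M) :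
    Module.Injective Rᵐᵒᵖ (LeftModuleDual R M) where
  out A B _ _ _ _ f hf g := by
    obtain ⟨ψ, hψ⟩ := exists_character_comp_eq (RTensor.mapLeft R f M) (hM A B f hf)
      (RTensor.uncurry (flipToRightDual g))
    refine ⟨flipToLeftDual (RTensor.curry ψ), fun x ↦ DFunLike.ext _ _ fun y ↦ ?_⟩
    exact hψ (RTensor.tmul x y)

lemma isFlatModule_of_injective_leftModuleDual
    (hM : Module.Injective Rᵐᵒᵖ (LeftModuleDual R M)) : IsFlatModule R M := by
  intro A B _ _ _ _ f hf
  refine (injective_iff_map_eq_zero _).2 fun z hz ↦ ?_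
  refine CharacterModule.eq_zero_of_character_apply fun c ↦ ?_
  obtain ⟨g, hg⟩ := hM.out f hf (flipToLeftDual (RTensor.curry c))
  have : (RTensor.uncurry (flipToRightDual g)).comp (RTensor.mapLeft R f M) = c :=
    RTensor.addHom_ext fun x y ↦ DFunLike.congr_fun (hg x) y
  exact (DFunLike.congr_fun this z).symm.trans (by simp [hz])

lemma isFlatModule_of_projective [Module.Projective R M] : IsFlatModule R M := by
  refine isFlatModule_of_injective_leftModuleDual ⟨fun A B _ _ _ _ f hf g ↦ ?_⟩
  obtain ⟨h, hh⟩ := Module.projective_lifting_property (RightModuleDual.map f) (flipToRightDual g)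
    (RightModuleDual.map_surjective f hf)
  exact ⟨flipToLeftDual h, fun x ↦ DFunLike.ext _ _ fun y ↦
    DFunLike.congr_fun (LinearMap.congr_fun hh y) x⟩

/-- A right exact sequence `K → P → F → 0` of left modules induces a left exact sequence
on character modules. -/
lemma LeftModuleDual.exists_map_eq_of_map_eq_zero {K P F : Type u} [AddCommGroup K] [Module R K]
    [AddCommGroup P] [Module R P] [AddCommGroup F] [Module R F] {f : K →ₗ[R] P} {g : P →ₗ[R] F}
    (hg : Function.Surjective g) (hfg : Function.Exact f g) (φ : LeftModuleDual R P)
    (hφ : LeftModuleDual.map f φ = 0) : ∃ ψ : LeftModuleDual R F, LeftModuleDual.map g ψ = φ := by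
  have key : ∀ p, g p = 0 → φ p = 0 := fun p hp ↦ by
    obtain ⟨k, rfl⟩ := (hfg p).1 hp
    exact DFunLike.congr_fun hφ k
  let ψ : F →+ AddCircle (1 : ℚ) := (AddMonoidHom.liftOfSurjective g.toAddMonoidHom hg)
    ⟨AddMonoidHomClass.toAddMonoidHom φ, key⟩
  exact ⟨ψ, DFunLike.ext _ _ fun p ↦ 
    AddMonoidHom.liftOfRightInverse_comp_apply g.toAddMonoidHom _ (Function.rightInverse_surjInv hg)
      ⟨AddMonoidHomClass.toAddMonoidHom φ, key⟩ p⟩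

lemma LeftModuleDual.map_injective {g : M →ₗ[R] M'} (hg : Function.Surjective g) :
    Function.Injective (LeftModuleDual.map g) := fun φ ψ h ↦ DFunLike.ext _ _ fun x ↦ by
  obtain ⟨x, rfl⟩ := hg x
  exact DFunLike.congr_fun h x

/-- If `F` is flat, then the map on character modules induced by the inclusion of the kernel of
a surjection `P → F` has a section. -/
lemma IsFlatModule.exists_section_map {K P F : Type u} [AddCommGroup K] [Module R K]
    [AddCommGroup P] [Module R P] [AddCommGroup F] [Module R F] (hF : IsFlatModule R F)
    {f : K →ₗ[R] P} {g : P →ₗ[R] F} (hf : Function.Injective f)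
    (hg : Function.Surjective g) (hfg : Function.Exact f g) :
    ∃ s : LeftModuleDual R K →ₗ[Rᵐᵒᵖ] LeftModuleDual R P,
      ∀ φ, LeftModuleDual.map f (s φ) = φ := by
  obtain ⟨r, hr⟩ := hF.injective_leftModuleDual.out (LeftModuleDual.map g)
    (LeftModuleDual.map_injective hg) LinearMap.id
  have hex : Function.Exact (LeftModuleDual.map g) (LeftModuleDual.map f) := fun φ ↦
    ⟨LeftModuleDual.exists_map_eq_of_map_eq_zero hg hfg φ, by
      rintro ⟨ψ, rfl⟩
      refine DFunLike.ext _ _ fun k ↦ ?_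
      simp [hfg.apply_apply_eq_zero]⟩
  have hsplit := hex.split_tfae'.out 0 1
  obtain ⟨-, s, hs⟩ := hsplit.2 ⟨LeftModuleDual.map_surjective f hf, r, LinearMap.ext hr⟩
  exact ⟨s, LinearMap.congr_fun hs⟩

lemma IsFlatModule.of_exact {K P F : Type u} [AddCommGroup K] [Module R K]
    [AddCommGroup P] [Module R P] [AddCommGroup F] [Module R F] (hP : IsFlatModule R P)
    (hF : IsFlatModule R F) {f : K →ₗ[R] P} {g : P →ₗ[R] F} (hf : Function.Injective f)
    (hg : Function.Surjective g) (hfg : Function.Exact f g) : IsFlatModule R K := by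
  obtain ⟨s, hs⟩ := hF.exists_section_map hf hg hfg
  refine isFlatModule_of_injective_leftModuleDual ⟨fun A B _ _ _ _ i hi φ ↦ ?_⟩
  obtain ⟨ψ, hψ⟩ := hP.injective_leftModuleDual.out i hi (s ∘ₗ φ)
  exact ⟨LeftModuleDual.map f ∘ₗ ψ, fun x ↦ by simp [hψ, hs]⟩

/-- Maps into the character module of a right module extend along pure monomorphisms. -/
lemma IsFlatModule.exists_extension {K P F : Type u} [AddCommGroup K] [Module R K]
    [AddCommGroup P] [Module R P] [AddCommGroup F] [Module R F] (hF : IsFlatModule R F)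
    {f : K →ₗ[R] P} {g : P →ₗ[R] F} (hf : Function.Injective f) (hg : Function.Surjective g)
    (hfg : Function.Exact f g) (φ : K →ₗ[R] RightModuleDual R I) :
    ∃ ψ : P →ₗ[R] RightModuleDual R I, ψ ∘ₗ f = φ := by
  obtain ⟨s, hs⟩ := hF.exists_section_map hf hg hfg
  exact ⟨flipToRightDual (s ∘ₗ flipToLeftDual φ), LinearMap.ext fun y ↦ DFunLike.ext _ _ fun x ↦
    DFunLike.congr_fun (hs (flipToLeftDual φ x)) y⟩

variable {M'' : Type u} [AddCommGroup M''] [Module R M'']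

/-- Exactness of `I ⊗_R −` on `M → M' → M''` is equivalent to exactness of `Hom_R(−, I⁺)`. -/
lemma RTensor.range_eq_ker_iff (f : M →ₗ[R] M') (g : M' →ₗ[R] M'') (hgf : g ∘ₗ f = 0) :
    (RTensor.mapRight R I f).range = (RTensor.mapRight R I g).ker ↔
      ∀ φ : M' →ₗ[R] RightModuleDual R I, φ ∘ₗ f = 0 →
        ∃ ψ : M'' →ₗ[R] RightModuleDual R I, ψ ∘ₗ g = φ := by
  constructor
  · intro h φ hφ
    have hker : ∀ z ∈ (RTensor.mapRight R I g).ker, RTensor.uncurry φ z = 0 := by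
      rw [← h]
      rintro _ ⟨z, rfl⟩
      have : (RTensor.uncurry φ).comp (RTensor.mapRight R I f) = 0 :=
        RTensor.addHom_ext fun x y ↦ DFunLike.congr_fun (LinearMap.congr_fun hφ y) x
      exact DFunLike.congr_fun this z
    obtain ⟨ψ, hψ⟩ := exists_character_comp_eq
      (QuotientAddGroup.kerLift (RTensor.mapRight R I g))
      (QuotientAddGroup.kerLift_injective _) (QuotientAddGroup.lift _ (RTensor.uncurry φ) hker)
    exact ⟨RTensor.curry ψ, LinearMap.ext fun y ↦ DFunLike.ext _ _ fun x ↦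
      hψ (QuotientAddGroup.mk (RTensor.tmul x y))⟩
  · intro h
    refine le_antisymm ?_ fun z hz ↦ ?_
    · rintro _ ⟨z, rfl⟩
      have : (RTensor.mapRight R I g).comp (RTensor.mapRight R I f) = 0 :=
        RTensor.addHom_ext fun x y ↦ by
          have : g (f y) = 0 := LinearMap.congr_fun hgf y
          have h0 : RTensor.tmul (R := R) x (0 : M'') = 0 := by
            rw [RTensor.tmul, TensorProduct.tmul_zero]; rfl
          simp [this, h0]
      exact DFunLike.congr_fun this z
    · rw [← QuotientAddGroup.eq_zero_iff]
      refine CharacterModule.eq_zero_of_character_apply fun c ↦ ?_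
      let φ : RTensor R I M' →+ AddCircle (1 : ℚ) :=
        AddMonoidHom.comp (P := AddCircle (1 : ℚ)) c (QuotientAddGroup.mk' _)
      obtain ⟨ψ, hψ⟩ := h (RTensor.curry φ) (LinearMap.ext fun y ↦ DFunLike.ext _ _ fun x ↦ by
        have : (QuotientAddGroup.mk (RTensor.tmul x (f y)) :
            RTensor R I M' ⧸ (RTensor.mapRight R I f).range) = 0 :=
          (QuotientAddGroup.eq_zero_iff _).2 ⟨RTensor.tmul x y, rfl⟩
        exact (congrArg c this).trans (map_zero c))
      have : (RTensor.uncurry ψ).comp (RTensor.mapRight R I g) = φ :=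
        RTensor.addHom_ext fun x y ↦ DFunLike.congr_fun (LinearMap.congr_fun hψ y) x
      exact (DFunLike.congr_fun this z).symm.trans
        ((congrArg (RTensor.uncurry ψ) hz).trans (map_zero _))

end Duality

section GorensteinFlat

open Abelian

variable {R : Type u} [Ring R]

lemma ModuleCat.shortExact_of_linearMap {K G M : ModuleCat.{u} R} (f : K →ₗ[R] G) (g : G →ₗ[R] M)
    (hf : Function.Injective f) (hg : Function.Surjective g) (hfg : Function.Exact f g) :
    (ShortComplex.mk (ModuleCat.ofHom f) (ModuleCat.ofHom g)
      (ModuleCat.hom_ext hfg.linearMap_comp_eq_zero)).ShortExact where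
  exact := (ShortComplex.ShortExact.moduleCat_exact_iff_function_exact _).mpr hfg
  mono_f := (ModuleCat.mono_iff_injective _).2 hf
  epi_g := (ModuleCat.epi_iff_surjective _).2 hg

lemma subsingleton_ext_of_projective {P : ModuleCat.{u} R} (hP : Module.Projective R P)
    (X : ModuleCat.{u} R) (k : ℕ) : Subsingleton (Ext P X (k + 1)) :=
  have : Projective P := P.projective_of_categoryTheory_projective
  Ext.subsingleton_of_projective P X k

section Complexes

variable {F : ℤ → ModuleCat.{u} R} {d : ∀ i : ℤ, F i →ₗ[R] F (i + 1)}

lemma exact_subtype_rangeRestrict (hd : ∀ i, LinearMap.range (d i) = LinearMap.ker (d (i + 1)))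
    (i : ℤ) : Function.Exact (LinearMap.range (d i)).subtype (d (i + 1)).rangeRestrict := by
  rw [LinearMap.exact_iff, LinearMap.ker_rangeRestrict, Submodule.range_subtype, hd]

/-- The short exact sequence `0 → Im (d i) → F (i + 1) → Im (d (i + 1)) → 0` obtained from an
exact complex. -/
lemma shortExact_range (hd : ∀ i, LinearMap.range (d i) = LinearMap.ker (d (i + 1))) (i : ℤ) :
    (ShortComplex.mk (X₁ := ModuleCat.of R (LinearMap.range (d i))) (X₂ := F (i + 1))
      (X₃ := ModuleCat.of R (LinearMap.range (d (i + 1))))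
      (ModuleCat.ofHom (LinearMap.range (d i)).subtype)
      (ModuleCat.ofHom (d (i + 1)).rangeRestrict)
      (ModuleCat.hom_ext (exact_subtype_rangeRestrict hd i).linearMap_comp_eq_zero)).ShortExact :=
  ModuleCat.shortExact_of_linearMap (K := ModuleCat.of R (LinearMap.range (d i))) (G := F (i + 1))
    (M := ModuleCat.of R (LinearMap.range (d (i + 1)))) _ _ (Submodule.injective_subtype _)
    (LinearMap.surjective_rangeRestrict _) (exact_subtype_rangeRestrict hd i)

/-- If `Hom(−, X)` leaves an exact complex of `Hom(−, X)`-acyclic modules exact, then its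
images are `Hom(−, X)`-acyclic. -/
lemma subsingleton_ext_range (hd : ∀ i, LinearMap.range (d i) = LinearMap.ker (d (i + 1)))
    {X : ModuleCat.{u} R} (hF : ∀ i k, Subsingleton (Ext (F i) X (k + 1)))
    (hX : ∀ (i : ℤ) (φ : F (i + 1) →ₗ[R] X), φ ∘ₗ d i = 0 →
      ∃ ψ : F (i + 1 + 1) →ₗ[R] X, ψ ∘ₗ d (i + 1) = φ) (k : ℕ) (i : ℤ) :
    Subsingleton (Ext (ModuleCat.of R (LinearMap.range (d i))) X (k + 1)) := by
  induction k generalizing i with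
  | zero =>
    obtain ⟨j, rfl⟩ : ∃ j, i = j + 1 + 1 := ⟨i - 2, by ring⟩
    refine (shortExact_range hd (j + 1)).subsingleton_ext_one X (fun φ ↦ ?_) (hF _ 0)
    obtain ⟨ψ, hψ⟩ := hX j (φ.hom ∘ₗ (d (j + 1)).rangeRestrict) (by
      have : (d (j + 1)).rangeRestrict ∘ₗ d j = 0 := LinearMap.ext fun x ↦ Subtype.ext <|
        (hd j).le ⟨x, rfl⟩
      rw [LinearMap.comp_assoc, this, LinearMap.comp_zero])
    refine ⟨ModuleCat.ofHom ψ, ModuleCat.hom_ext (LinearMap.ext ?_)⟩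
    rintro ⟨_, x, rfl⟩
    exact LinearMap.congr_fun hψ x
  | succ k ih =>
    obtain ⟨j, rfl⟩ : ∃ j, i = j + 1 := ⟨i - 1, by ring⟩
    exact (shortExact_range hd j).subsingleton_ext_X₃ X (k + 1) (ih j) (hF _ _)

/-- If the `Ext`-dimension with values in `X` is bounded, then `Hom(−, X)` leaves exact
complexes of `Hom(−, X)`-acyclic modules exact. -/
lemma exists_comp_eq_of_subsingleton_ext
    (hd : ∀ i, LinearMap.range (d i) = LinearMap.ker (d (i + 1))) {X : ModuleCat.{u} R}
    (hF : ∀ i k, Subsingleton (Ext (F i) X (k + 1))) {n : ℕ}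
    (hX : ∀ M : ModuleCat.{u} R, Subsingleton (Ext M X (n + 1))) (i : ℤ)
    (φ : F (i + 1) →ₗ[R] X) (hφ : φ ∘ₗ d i = 0) :
    ∃ ψ : F (i + 1 + 1) →ₗ[R] X, ψ ∘ₗ d (i + 1) = φ := by
  have key : ∀ (k : ℕ) (j : ℤ), k ≤ n →
      Subsingleton (Ext (ModuleCat.of R (LinearMap.range (d j))) X (n - k + 1)) := by
    intro k
    induction k with
    | zero => exact fun j _ ↦ hX _
    | succ k ih =>
      intro j hk
      refine (shortExact_range hd j).subsingleton_ext_X₁ X _ (hF _ _) ?_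
      rw [show n - (k + 1) + 1 = n - k by omega]
      exact ih (j + 1) (by omega)
  have h1 := key n (i + 1 + 1) le_rfl
  rw [Nat.sub_self] at h1
  let e := (d (i + 1)).quotKerEquivRange
  have hker : LinearMap.ker (d (i + 1)) ≤ LinearMap.ker φ := by
    rw [← hd]
    rintro _ ⟨x, rfl⟩
    exact LinearMap.congr_fun hφ x
  obtain ⟨ψ, hψ⟩ := (shortExact_range hd (i + 1)).exists_comp_eq_of_subsingleton_ext_one X h1
    (ModuleCat.ofHom ((LinearMap.ker (d (i + 1))).liftQ φ hker ∘ₗ e.symm.toLinearMap))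
  refine ⟨ψ.hom, LinearMap.ext fun x ↦ ?_⟩
  have hx : e.symm ⟨d (i + 1) x, x, rfl⟩ = Submodule.Quotient.mk x :=
    (LinearEquiv.symm_apply_eq _).2 rfl
  have := LinearMap.congr_fun (congrArg ModuleCat.Hom.hom hψ) ⟨d (i + 1) x, x, rfl⟩
  refine this.trans ?_
  change (LinearMap.ker (d (i + 1))).liftQ φ hker (e.symm _) = _
  rw [hx, Submodule.liftQ_apply]

end Complexes

variable {I : Type u} [AddCommGroup I] [Module Rᵐᵒᵖ I]

lemma IsFlatModule.subsingleton_ext {F : ModuleCat.{u} R} (hF : IsFlatModule R F) (k : ℕ) :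
    Subsingleton (Ext F (ModuleCat.of R (RightModuleDual R I)) (k + 1)) := by
  induction k generalizing F with
  | zero =>
    have hg := Finsupp.linearCombination_id_surjective R F
    have hex := LinearMap.exact_subtype_ker_map (Finsupp.linearCombination R (id : F → F))
    refine (ModuleCat.shortExact_of_linearMap (K := ModuleCat.of R _)
      (G := ModuleCat.of R (F →₀ R)) (M := F) _ _ (Submodule.injective_subtype _) hg
      hex).subsingleton_ext_one _ (fun φ ↦ ?_)
      (subsingleton_ext_of_projective (Module.Projective.of_free (P := F →₀ R)) _ 0)
    obtain ⟨ψ, hψ⟩ := hF.exists_extension (Submodule.injective_subtype _) hg hex φ.hom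
    exact ⟨ModuleCat.ofHom ψ, ModuleCat.hom_ext hψ⟩
  | succ k ih =>
    have hg := Finsupp.linearCombination_id_surjective R F
    have hex := LinearMap.exact_subtype_ker_map (Finsupp.linearCombination R (id : F → F))
    have hP : IsFlatModule R (F →₀ R) := isFlatModule_of_projective
    exact (ModuleCat.shortExact_of_linearMap (K := ModuleCat.of R _)
      (G := ModuleCat.of R (F →₀ R)) (M := F) _ _ (Submodule.injective_subtype _) hg
      hex).subsingleton_ext_X₃ _ (k + 1)
      (ih (hP.of_exact hF (Submodule.injective_subtype _) hg hex))
      (subsingleton_ext_of_projective (Module.Projective.of_free (P := F →₀ R)) _ (k + 1))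

lemma comp_eq_zero_of_range_eq_ker {A B D : Type u} [AddCommGroup A] [Module R A] [AddCommGroup B]
    [Module R B] [AddCommGroup D] [Module R D] {f : A →ₗ[R] B} {g : B →ₗ[R] D}
    (h : LinearMap.range f = LinearMap.ker g) : g ∘ₗ f = 0 :=
  LinearMap.range_le_ker_iff.1 h.le

lemma IsGorensteinFlat.subsingleton_ext {G : ModuleCat.{u} R} (hG : IsGorensteinFlat R G)
    (hI : Module.Injective Rᵐᵒᵖ I) (k : ℕ) :
    Subsingleton (Ext G (ModuleCat.of R (RightModuleDual R I)) (k + 1)) := by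
  obtain ⟨F, d, hF, hd, ⟨e⟩, hexact⟩ := hG
  refine Iso.subsingleton_ext (N := ModuleCat.of R _) e.toModuleIso _ _ ?_
  refine subsingleton_ext_range hd (fun i k ↦ (hF i).subsingleton_ext k) (fun i φ hφ ↦ ?_) k 0
  exact (RTensor.range_eq_ker_iff _ _ (comp_eq_zero_of_range_eq_ker (hd i))).1
    (hexact I hI i) φ hφ

lemma gfdLE.subsingleton_ext {n : ℕ} {M : ModuleCat.{u} R} (hM : gfdLE R n M)
    (hI : Module.Injective Rᵐᵒᵖ I) {k : ℕ} (hk : n ≤ k) :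
    Subsingleton (Ext M (ModuleCat.of R (RightModuleDual R I)) (k + 1)) := by
  induction n generalizing M k with
  | zero => exact IsGorensteinFlat.subsingleton_ext hM hI k
  | succ n ih =>
    obtain ⟨K, G, f, g, hG, hf, hg, hfg, hK⟩ := hM
    obtain ⟨k, rfl⟩ : ∃ m, k = m + 1 := ⟨k - 1, by omega⟩
    exact (ModuleCat.shortExact_of_linearMap f g hf hg
      (LinearMap.exact_iff.2 hfg.symm)).subsingleton_ext_X₃ _ (k + 1) (ih hK (by omega))
      (hG.subsingleton_ext hI _)

lemma exists_gfdLE_of_gfd_le {n : ℕ} {M : ModuleCat.{u} R} (hM : gfd R M ≤ n) :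
    ∃ m ≤ n, gfdLE R m M := by
  have hlt : gfd R M < (n + 1 : ℕ) := hM.trans_lt (by exact_mod_cast n.lt_succ_self)
  obtain ⟨_, ⟨m, rfl, hm⟩, hmn⟩ := sInf_lt_iff.1 hlt
  exact ⟨m, Nat.lt_succ_iff.1 (by exact_mod_cast hmn), hm⟩

end GorensteinFlat

/-- If the left weak Gorenstein global dimension `l.wGgldim(R) = sup {Gfd_R(M)}` is
finite, then every Gorenstein projective module is Gorenstein flat. -/
theorem gorensteinProjective_isGorensteinFlat_of_wGgldim_finite (R : Type u) [Ring R]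
    (h : (⨆ M : ModuleCat.{u} R, gfd R M) ≠ ⊤) :
    ∀ M : ModuleCat.{u} R, IsGorensteinProjective R M → IsGorensteinFlat R M := by
  obtain ⟨n, hn⟩ := WithTop.ne_top_iff_exists.1 h
  rintro M ⟨P, d, hP, hd, e, -⟩
  have hflat : ∀ i, IsFlatModule R (P i) := fun i ↦
    have := hP i
    isFlatModule_of_projective
  refine ⟨P, d, hflat, hd, e, fun I _ _ hI i ↦ ?_⟩
  refine (RTensor.range_eq_ker_iff _ _ (comp_eq_zero_of_range_eq_ker (hd i))).2 ?_
  refine exists_comp_eq_of_subsingleton_ext (X := ModuleCat.of R (RightModuleDual R I)) hd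
    (fun i k ↦ (hflat i).subsingleton_ext k) (n := n) (fun N ↦ ?_) i
  obtain ⟨m, hm, hN⟩ := exists_gfdLE_of_gfd_le ((le_iSup (gfd R) N).trans hn.ge)
  exact hN.subsingleton_ext hI hm
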